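/- For all positive integers k and p, the number of domino tilings of the region T(k,k+2,p) is even if k is odd, and is odd if k is even. -/

import Mathlib

/-- Two cells of `ℤ × ℤ` are adjacent if they differ by `(1,0)` or `(0,1)`. -/
def Adjacent (a b : ℤ × ℤ) : Prop :=
  (a.1 = b.1 ∧ (a.2 = b.2 + 1 ∨ b.2 = a.2 + 1)) ∨
  (a.2 = b.2 ∧ (a.1 = b.1 + 1 ∨ b.1 = a.1 + 1))

/-- `T` is a domino tiling of `R`: a partition of `R` into two-element sets of adjacent cells. -/
def IsDominoTiling (R : Set (ℤ × ℤ)) (T : Set (Set (ℤ × ℤ))) : Prop :=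
  (∀ d ∈ T, ∃ a b, Adjacent a b ∧ d = {a, b}) ∧
  T.PairwiseDisjoint id ∧
  ⋃₀ T = R

/-- The number of domino tilings of `R`. -/
noncomputable def numTilings (R : Set (ℤ × ℤ)) : ℕ :=
  Nat.card {T : Set (Set (ℤ × ℤ)) // IsDominoTiling R T}

/-- The region `T(i,j,p)`: rows `r = 0, …, i+p-2` from top to bottom of lengths
`j, j+2, …, j+2(p-2)` followed by `i` rows of length `j+2(p-1)`, centers aligned. -/
def Treg (i j p : ℕ) : Set (ℤ × ℤ) :=
  {q | 0 ≤ q.2 ∧ q.2 ≤ (i : ℤ) + p - 2 ∧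
    (p : ℤ) - 1 - min q.2 ((p : ℤ) - 1) ≤ q.1 ∧
    q.1 ≤ (p : ℤ) - 2 + j + min q.2 ((p : ℤ) - 1)}

/-- Shifted region. -/
def Rg (k p c r : ℤ) : Prop :=
  0 ≤ r ∧ r ≤ k + p - 2 ∧ -r ≤ c ∧ -(p - 1) ≤ c ∧ c ≤ k + 1 + r ∧ c ≤ k + p

theorem z2a : ∀ x y z w : ZMod 2, x + y + z + w = 0 → z + y = x + w := by decide
theorem z2b : ∀ x y z w : ZMod 2, x + y + z + w = 0 → z + x = y + w := by decide
theorem z2c : ∀ x y : ZMod 2, x + y = 0 → x = y := by decide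

section kernel
variable (k p : ℤ) (f : ℤ → ℤ → ZMod 2)

theorem A_const (h : ∀ c r, Rg k p c r → (c + r) % 2 = 1 →
      f (c-1) r + f (c+1) r + f c (r-1) + f c (r+1) = 0) (c r : ℤ) (n : ℕ)
    (h1 : Rg k p c r) (h2 : Rg k p (c + n) (r - n)) (ho : (c + r) % 2 = 1) :
    f c (r-1) + f (c+1) r = f (c+n) (r-n-1) + f (c+n+1) (r-n) := by
  induction n with
  | zero => simp
  | succ n ih =>
    have h3 : Rg k p (c + n) (r - n) := by
      unfold Rg at *; push_cast at *; omega
    rw [ih h3]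
    have := z2a _ _ _ _ (h _ _ h2 (by push_cast; omega))
    rw [this]
    push_cast
    have e1 : c + ((n:ℤ)+1) - 1 = c + n := by ring
    have e2 : r - ((n:ℤ)+1) + 1 = r - n := by ring
    have e3 : r - ((n:ℤ)+1) = r - n - 1 := by ring
    have e4 : c + ((n:ℤ)+1) = c + n + 1 := by ring
    rw [e1, e2, e3, e4]

theorem B_const (h : ∀ c r, Rg k p c r → (c + r) % 2 = 1 →
      f (c-1) r + f (c+1) r + f c (r-1) + f c (r+1) = 0) (c r : ℤ) (n : ℕ)
    (h1 : Rg k p c r) (h2 : Rg k p (c + n) (r + n)) (ho : (c + r) % 2 = 1) :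
    f c (r-1) + f (c-1) r = f (c+n) (r+n-1) + f (c+n-1) (r+n) := by
  induction n with
  | zero => simp
  | succ n ih =>
    have h3 : Rg k p (c + n) (r + n) := by
      unfold Rg at *; push_cast at *; omega
    rw [ih h3]
    have := z2b _ _ _ _ (h _ _ h3 (by omega))
    rw [this]
    push_cast
    have e1 : c + ((n:ℤ)+1) - 1 = c + n := by ring
    have e2 : r + ((n:ℤ)+1) - 1 = r + n := by ring
    have e3 : r + ((n:ℤ)+1) = r + n + 1 := by ring
    have e4 : c + ((n:ℤ)+1) = c + n + 1 := by ring
    rw [e1, e2, e3, e4, add_comm (f (c + n + 1) _)]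

theorem A_eq (h : ∀ c r, Rg k p c r → (c + r) % 2 = 1 →
      f (c-1) r + f (c+1) r + f c (r-1) + f c (r+1) = 0) (c r c' r' : ℤ)
    (h1 : Rg k p c r) (h2 : Rg k p c' r') (ho : (c + r) % 2 = 1) (he : c + r = c' + r') :
    f c (r-1) + f (c+1) r = f c' (r'-1) + f (c'+1) r' := by
  rcases le_total c c' with hc | hc
  · obtain ⟨n, hn⟩ := Int.eq_ofNat_of_zero_le (sub_nonneg.2 hc)
    obtain rfl : c' = c + n := by omega
    obtain rfl : r' = r - n := by omega
    exact A_const k p f h c r n h1 h2 ho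
  · obtain ⟨n, hn⟩ := Int.eq_ofNat_of_zero_le (sub_nonneg.2 hc)
    obtain rfl : c = c' + n := by omega
    obtain rfl : r = r' - n := by omega
    exact (A_const k p f h c' r' n h2 h1 (by omega)).symm

theorem B_eq (h : ∀ c r, Rg k p c r → (c + r) % 2 = 1 →
      f (c-1) r + f (c+1) r + f c (r-1) + f c (r+1) = 0) (c r c' r' : ℤ)
    (h1 : Rg k p c r) (h2 : Rg k p c' r') (ho : (c + r) % 2 = 1) (he : c - r = c' - r') :
    f c (r-1) + f (c-1) r = f c' (r'-1) + f (c'-1) r' := by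
  rcases le_total c c' with hc | hc
  · obtain ⟨n, hn⟩ := Int.eq_ofNat_of_zero_le (sub_nonneg.2 hc)
    obtain rfl : c' = c + n := by omega
    obtain rfl : r' = r + n := by omega
    exact B_const k p f h c r n h1 h2 ho
  · obtain ⟨n, hn⟩ := Int.eq_ofNat_of_zero_le (sub_nonneg.2 hc)
    obtain rfl : c = c' + n := by omega
    obtain rfl : r = r' + n := by omega
    exact (B_const k p f h c' r' n h2 h1 (by omega)).symm

theorem A_zero (hk : k % 2 = 0) (hk0 : 0 < k) (hp : 0 < p)
    (h0 : ∀ c r, ¬ Rg k p c r → f c r = 0)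
    (h : ∀ c r, Rg k p c r → (c + r) % 2 = 1 →
      f (c-1) r + f (c+1) r + f c (r-1) + f c (r+1) = 0) (c r : ℤ)
    (h1 : Rg k p c r) (ho : (c + r) % 2 = 1) : f c (r-1) + f (c+1) r = 0 := by
  have key : ∀ u : ℤ, u % 2 = 1 → k + 1 ≤ u → u ≤ k + 2 * p - 1 →
      ∀ c r, Rg k p c r → c + r = u → f c (r-1) + f (c+1) r = 0 := by
    intro u hu hu1 hu2 c r hR hcr
    have hx : Rg k p ((u + k + 1) / 2) ((u - k - 1) / 2) := by unfold Rg at *; omega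
    rw [A_eq k p f h c r _ _ hR hx (by omega) (by omega),
      h0 _ _ (by unfold Rg; omega), h0 _ _ (by unfold Rg; omega), add_zero]
  have key2 : ∀ c r, Rg k p c r → c + r = k - 1 → f c (r-1) + f (c+1) r = 0 := by
    intro c r hR hcr
    have hx : Rg k p (1 - p) (k + p - 2) := by unfold Rg at *; omega
    rw [A_eq k p f h c r _ _ hR hx (by omega) (by omega),
      z2a _ _ _ _ (h _ _ hx (by omega)),
      h0 _ _ (by unfold Rg; omega), h0 _ _ (by unfold Rg; omega), add_zero]
  -- reflection about k - 1
  have key3 : ∀ u : ℤ, u % 2 = 1 → 1 ≤ u → u ≤ k - 3 →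
      (∀ c r, Rg k p c r → c + r = 2 * k - 2 - u → f c (r-1) + f (c+1) r = 0) →
      ∀ c r, Rg k p c r → c + r = u → f c (r-1) + f (c+1) r = 0 := by
    intro u hu hu1 hu2 hZ c r hR hcr
    have hx : Rg k p (1 - p) (u + p - 1) := by unfold Rg at *; omega
    have hy : Rg k p (1 - p) (u + p + 1) := by unfold Rg at *; omega
    have hz : Rg k p (k - p - 2 - u) (k + p - 2) := by unfold Rg at *; omega
    have hw : Rg k p (k - p - u) (k + p - 2) := by unfold Rg at *; omega
    have e1 := A_eq k p f h c r _ _ hR hx (by omega) (by omega)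
    have e2 := z2a _ _ _ _ (h _ _ hx (by omega))
    have e3 := B_eq k p f h _ _ _ _ hy hz (by omega) (by omega)
    have e4 := z2b _ _ _ _ (h _ _ hz (by omega))
    have e5 := z2a _ _ _ _ (h _ _ hw (by omega))
    have e6 := hZ _ _ hw (by omega)
    have w1 : f (1 - p - 1) (u + p - 1) = 0 := h0 _ _ (by unfold Rg; omega)
    have w2 : f (1 - p - 1) (u + p + 1) = 0 := h0 _ _ (by unfold Rg; omega)
    have w3 : f (k - p - 2 - u) (k + p - 2 + 1) = 0 := h0 _ _ (by unfold Rg; omega)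
    have w4 : f (k - p - u) (k + p - 2 + 1) = 0 := h0 _ _ (by unfold Rg; omega)
    have s1 : u + p - 1 + 1 = u + p + 1 - 1 := by ring
    have s2 : k - p - u - 1 = k - p - 2 - u + 1 := by ring
    rw [s1] at e2
    rw [s2] at e5
    rw [w1, zero_add] at e2
    rw [w2, add_zero] at e3
    rw [w3, add_zero] at e4
    rw [w4, add_zero] at e5
    rw [e1, e2, e3, e4, ← e5, e6]
  have key4 : ∀ u : ℤ, u % 2 = 1 → 3 ≤ u → u ≤ k - 1 →
      (∀ c r, Rg k p c r → c + r = u → f c (r-1) + f (c+1) r = 0) →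
      ∀ c r, Rg k p c r → c + r = 2 * k + 2 * p - u → f c (r-1) + f (c+1) r = 0 := by
    intro u hu hu1 hu2 hZ c r hR hcr
    have hx : Rg k p u 0 := by unfold Rg at *; omega
    have hy : Rg k p (u + 2) 0 := by unfold Rg at *; omega
    have hz : Rg k p (k + p) (k + p - u - 2) := by unfold Rg at *; omega
    have hw : Rg k p (k + p) (k + p - u) := by unfold Rg at *; omega
    have e1 := A_eq k p f h c r _ _ hR hw (by omega) (by omega)
    have e3 := B_eq k p f h _ _ _ _ hy hz (by omega) (by omega)
    have e4 := z2b _ _ _ _ (h _ _ hz (by omega))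
    have e6 := hZ _ _ hx (by omega)
    have w1 : f u (0 - 1) = 0 := h0 _ _ (by unfold Rg; omega)
    have w2 : f (u + 2) (0 - 1) = 0 := h0 _ _ (by unfold Rg; omega)
    have w3 : f (k + p + 1) (k + p - u) = 0 := h0 _ _ (by unfold Rg; omega)
    have w4 : f (k + p + 1) (k + p - u - 2) = 0 := h0 _ _ (by unfold Rg; omega)
    have s1 : u + 2 - 1 = u + 1 := by ring
    have s2 : k + p - u - 2 + 1 = k + p - u - 1 := by ring
    rw [w1, zero_add] at e6
    rw [w2, zero_add, s1, e6] at e3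
    rw [w4, zero_add, s2] at e4
    rw [e1, w3, add_zero, ← e4, ← e3]
  have key5 : ∀ n : ℕ, ∀ u : ℤ, u = k - 1 - 2 * n → 1 ≤ u →
      ∀ c r, Rg k p c r → c + r = u → f c (r-1) + f (c+1) r = 0 := by
    intro n
    induction n using Nat.strong_induction_on with
    | _ n ih =>
      intro u hu hu1
      rcases Nat.eq_zero_or_pos n with rfl | hn
      · intro c r hR hcr
        exact key2 c r hR (by omega)
      · refine key3 u (by omega) hu1 (by omega) ?_
        by_cases hb : 2 * k - 2 - u ≤ k + 2 * p - 1
        · exact key _ (by omega) (by omega) hb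
        · have := key4 (u + 2 * p + 2) (by omega) (by omega) (by omega)
            (ih (n - (p + 1).toNat) (by omega) _ (by omega) (by omega))
          intro c r hR hcr
          exact this c r hR (by omega)
  have key6 : ∀ u : ℤ, u % 2 = 1 → 1 ≤ u → u ≤ k - 1 →
      ∀ c r, Rg k p c r → c + r = u → f c (r-1) + f (c+1) r = 0 := by
    intro u hu hu1 hu2
    exact key5 ((k - 1 - u) / 2).toNat u (by omega) hu1
  by_cases hb : c + r ≤ k - 1
  · exact key6 _ ho (by unfold Rg at h1; omega) hb c r h1 rfl
  by_cases hb2 : c + r ≤ k + 2 * p - 1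
  · exact key _ ho (by omega) hb2 c r h1 rfl
  · exact key4 (2 * k + 2 * p - (c + r)) (by omega) (by unfold Rg at h1; omega) (by omega)
      (key6 _ (by omega) (by unfold Rg at h1; omega) (by omega)) c r h1 (by omega)

theorem even_zero (hk : k % 2 = 0) (hk0 : 0 < k) (hp : 0 < p)
    (h0 : ∀ c r, ¬ Rg k p c r → f c r = 0)
    (h : ∀ c r, Rg k p c r → (c + r) % 2 = 1 →
      f (c-1) r + f (c+1) r + f c (r-1) + f c (r+1) = 0) (c r : ℤ)
    (ho : (c + r) % 2 = 0) : f c r = 0 := by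
  have hA := A_zero k p f hk hk0 hp h0 h
  by_cases hv : 2 ≤ c - r
  · have : ∀ n : ℕ, ∀ c r : ℤ, r = n - 1 → (c + r) % 2 = 0 → 2 ≤ c - r → f c r = 0 := by
      intro n
      induction n with
      | zero => intro c r hr _ _; exact h0 _ _ (by unfold Rg; push_cast at *; omega)
      | succ n ih =>
        intro c r hr ho hv
        by_cases hR : Rg k p c r
        · have hR' : Rg k p (c - 1) r := by unfold Rg at *; push_cast at *; omega
          have e := z2c _ _ (hA _ _ hR' (by omega))
          rw [sub_add_cancel] at e
          rw [← e]
          exact ih _ _ (by push_cast at *; omega) (by omega) (by omega)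
        · exact h0 _ _ hR
    by_cases hR : Rg k p c r
    · exact this (r + 1).toNat c r (by unfold Rg at hR; omega) ho hv
    · exact h0 _ _ hR
  · have : ∀ n : ℕ, ∀ c r : ℤ, r = k + p - 1 - n → (c + r) % 2 = 0 → c - r ≤ 0 → f c r = 0 := by
      intro n
      induction n with
      | zero => intro c r hr _ _; exact h0 _ _ (by unfold Rg; push_cast at *; omega)
      | succ n ih =>
        intro c r hr ho hv
        by_cases hR : Rg k p c r
        · have hR' : Rg k p (c + 1) r := by unfold Rg at *; push_cast at *; omega
          have e1 := hA _ _ hR' (by omega)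
          rw [z2a _ _ _ _ (h _ _ hR' (by omega))] at e1
          have e := z2c _ _ e1
          rw [add_sub_cancel_right] at e
          rw [e]
          exact ih _ _ (by push_cast at *; omega) (by omega) (by omega)
        · exact h0 _ _ hR
    by_cases hR : Rg k p c r
    · exact this (k + p - 1 - r).toNat c r (by unfold Rg at hR; omega) ho (by omega)
    · exact h0 _ _ hR

theorem all_zero (hk : k % 2 = 0) (hk0 : 0 < k) (hp : 0 < p)
    (h0 : ∀ c r, ¬ Rg k p c r → f c r = 0)
    (h : ∀ c r, Rg k p c r →
      f (c-1) r + f (c+1) r + f c (r-1) + f c (r+1) = 0) (c r : ℤ) : f c r = 0 := by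
  rcases Int.emod_two_eq_zero_or_one (c + r) with ho | ho
  · exact even_zero k p f hk hk0 hp h0 (fun c r hR _ => h c r hR) c r ho
  · have := even_zero k p (fun c r => f (k + 1 - c) r) hk hk0 hp
      (fun c r hR => h0 _ _ (by unfold Rg at *; omega))
      (fun c r hR _ => by
        have := h (k + 1 - c) r (by unfold Rg at *; omega)
        have s1 : k + 1 - (c - 1) = k + 1 - c + 1 := by ring
        have s2 : k + 1 - (c + 1) = k + 1 - c - 1 := by ring
        simp only [s1, s2]
        rw [← this]; ring) (k + 1 - c) r (by omega)
    simpa using this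

end kernel

theorem Adjacent.symm' {a b : ℤ × ℤ} (h : Adjacent a b) : Adjacent b a := by
  unfold Adjacent at *; omega

theorem Adjacent.ne' {a b : ℤ × ℤ} (h : Adjacent a b) : a ≠ b := by
  rintro rfl; unfold Adjacent at *; omega

/-- Matchings as involutions. -/
abbrev TInv (R : Set (ℤ × ℤ)) : Type :=
  {σ : Equiv.Perm R // (∀ x, Adjacent x.1 (σ x).1) ∧ ∀ x, σ (σ x) = x}

theorem tiling_of_inv {R : Set (ℤ × ℤ)} (σ : TInv R) :
    IsDominoTiling R {d | ∃ x : R, d = {x.1, (σ.1 x).1}} := by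
  obtain ⟨σ, h1, h2⟩ := σ
  refine ⟨?_, ?_, ?_⟩
  · rintro d ⟨x, rfl⟩
    exact ⟨_, _, h1 x, rfl⟩
  · rintro d ⟨x, rfl⟩ e ⟨y, rfl⟩ hne
    simp only [Function.onFun, id]
    rw [Set.disjoint_left]
    intro z hz hz'
    apply hne
    simp only [Set.mem_insert_iff, Set.mem_singleton_iff] at hz hz'
    rcases hz with hz | hz <;> rcases hz' with hz' | hz' <;>
      have he := Subtype.ext (hz.symm.trans hz')
    · rw [he]
    · rw [he]; simp only [h2]; rw [Set.pair_comm]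
    · rw [← he]; simp only [h2]; rw [Set.pair_comm]
    · rw [σ.injective he]
  · ext z
    constructor
    · rintro ⟨d, ⟨x, rfl⟩, hz⟩
      simp only [Set.mem_insert_iff, Set.mem_singleton_iff] at hz
      rcases hz with rfl | rfl <;> exact Subtype.prop _
    · intro hz
      exact ⟨_, ⟨⟨z, hz⟩, rfl⟩, by simp⟩

theorem card_inv (R : Set (ℤ × ℤ)) : numTilings R = Nat.card (TInv R) := by
  symm
  apply Nat.card_congr
  refine Equiv.ofBijective (fun σ => ⟨_, tiling_of_inv σ⟩) ⟨?_, ?_⟩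
  · rintro ⟨σ, h1, h2⟩ ⟨τ, g1, g2⟩ he
    have he := congrArg Subtype.val he
    simp only at he
    apply Subtype.ext
    ext1 x
    have hx : ({x.1, (σ x).1} : Set (ℤ × ℤ)) ∈ {d | ∃ x : R, d = {x.1, (τ x).1}} := by
      rw [← he]; exact ⟨x, rfl⟩
    obtain ⟨y, hy⟩ := hx
    have m1 : x.1 ∈ ({y.1, (τ y).1} : Set (ℤ × ℤ)) := by rw [← hy]; simp
    have m2 : (σ x).1 ∈ ({y.1, (τ y).1} : Set (ℤ × ℤ)) := by rw [← hy]; simp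
    simp only [Set.mem_insert_iff, Set.mem_singleton_iff] at m1 m2
    have hne := (h1 x).ne'
    rcases m1 with m1 | m1 <;> rcases m2 with m2 | m2
    · exact absurd (m1.trans m2.symm) hne
    · rw [Subtype.ext m1]; rw [Subtype.ext m1] at m2; exact Subtype.ext m2
    · have : x = τ y := Subtype.ext m1
      have h' : σ x = y := Subtype.ext m2
      show σ x = τ x
      rw [h', this, g2]
    · exact absurd (m1.trans m2.symm) hne
  · rintro ⟨T, t1, t2, t3⟩
    have ex : ∀ x : R, ∃ y : R, Adjacent x.1 y.1 ∧ ({x.1, y.1} : Set (ℤ × ℤ)) ∈ T := by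
      rintro ⟨x, hx⟩
      rw [← t3] at hx
      obtain ⟨d, hd, hxd⟩ := hx
      obtain ⟨a, b, hab, rfl⟩ := t1 d hd
      have ha : a ∈ R := by rw [← t3]; exact ⟨_, hd, by simp⟩
      have hb : b ∈ R := by rw [← t3]; exact ⟨_, hd, by simp⟩
      simp only [Set.mem_insert_iff, Set.mem_singleton_iff] at hxd
      rcases hxd with rfl | rfl
      · exact ⟨⟨b, hb⟩, hab, hd⟩
      · exact ⟨⟨a, ha⟩, hab.symm', by rw [Set.pair_comm]; exact hd⟩
    choose s hs1 hs2 using ex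
    have uniq : ∀ d ∈ T, ∀ e ∈ T, ∀ z, z ∈ d → z ∈ e → d = e := by
      intro d hd e he z hz hz'
      by_contra hne
      exact Set.disjoint_left.1 (t2 hd he hne) hz hz'
    have hs3 : ∀ x, s (s x) = x := by
      intro x
      have := uniq _ (hs2 x) _ (hs2 (s x)) (s x).1 (by simp) (by simp)
      have m : (s (s x)).1 ∈ ({x.1, (s x).1} : Set (ℤ × ℤ)) := by rw [this]; simp
      simp only [Set.mem_insert_iff, Set.mem_singleton_iff] at m
      rcases m with m | m
      · exact Subtype.ext m
      · exact absurd m.symm (hs1 (s x)).ne'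
    refine ⟨⟨⟨s, s, hs3, hs3⟩, hs1, hs3⟩, ?_⟩
    apply Subtype.ext
    simp only [Equiv.coe_fn_mk]
    ext d
    constructor
    · rintro ⟨x, rfl⟩; exact hs2 x
    · intro hd
      obtain ⟨a, b, hab, rfl⟩ := t1 d hd
      have ha : a ∈ R := by rw [← t3]; exact ⟨_, hd, by simp⟩
      exact ⟨⟨a, ha⟩, uniq _ hd _ (hs2 ⟨a, ha⟩) a (by simp) (by simp)⟩

open Classical in
theorem card_inv_mod (R : Set (ℤ × ℤ)) [Fintype R] :
    ((Nat.card (TInv R) : ℕ) : ZMod 2) =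
      (Matrix.of fun x y : R => if Adjacent x.1 y.1 then (1 : ZMod 2) else 0).det := by
  rw [Matrix.det_apply']
  have hsgn : ∀ σ : Equiv.Perm R, (((Equiv.Perm.sign σ : ℤˣ) : ℤ) : ZMod 2) = 1 := by
    intro σ
    rcases Int.units_eq_one_or (Equiv.Perm.sign σ) with h | h <;> rw [h] <;> decide
  have hprod : ∀ σ : Equiv.Perm R,
      ∏ i, (Matrix.of fun x y : R => if Adjacent x.1 y.1 then (1 : ZMod 2) else 0) (σ i) i
        = if (∀ x, Adjacent x.1 (σ x).1) then 1 else 0 := by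
    intro σ
    simp only [Matrix.of_apply]
    rw [Finset.prod_ite_zero]
    simp only [Finset.prod_const_one, Finset.mem_univ, true_implies]
    congr 1
    exact propext ⟨fun h x => (h x).symm', fun h x => (h x).symm'⟩
  simp only [hsgn, hprod, one_mul]
  rw [← Finset.sum_filter, Finset.sum_const, nsmul_eq_mul, mul_one]
  rw [Nat.card_eq_fintype_card]
  have hc := Fintype.card_subtype (fun σ : Equiv.Perm R => ∀ x, Adjacent x.1 (σ x).1)
  rw [← hc]
  let g : Function.End {σ : Equiv.Perm R // ∀ x, Adjacent x.1 (σ x).1} :=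
    fun σ => ⟨σ.1⁻¹, fun x => by
      have := σ.2 (σ.1⁻¹ x)
      rw [show σ.1 (σ.1⁻¹ x) = x from σ.1.apply_symm_apply x] at this
      exact this.symm'⟩
  have hg : g ^ (2 ^ 1) = 1 := by
    funext σ
    apply Subtype.ext
    show (σ.1⁻¹)⁻¹ = σ.1
    simp
  have hm := Equiv.Perm.card_fixedPoints_modEq (p := 2) (n := 1) hg
  rw [(ZMod.natCast_eq_natCast_iff _ _ 2).2 hm]
  congr 1
  apply Fintype.card_congr
  refine ⟨fun σ => ⟨⟨σ.1, σ.2.1⟩, ?_⟩, fun σ => ⟨σ.1.1, σ.1.2, ?_⟩, fun _ => rfl, fun _ => rfl⟩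
  · apply Subtype.ext
    show σ.1⁻¹ = σ.1
    ext1 x
    rw [Equiv.Perm.inv_eq_iff_eq, σ.2.2]
  · have h : σ.1.1⁻¹ = σ.1.1 := congrArg Subtype.val σ.2
    intro x
    have h' := congrFun (congrArg DFunLike.coe h) (σ.1.1 x)
    rw [← h']
    exact σ.1.1.symm_apply_apply x

theorem mem_Treg (k p : ℕ) (hp : 0 < p) (c r : ℤ) :
    (c + (p - 1), r) ∈ Treg k (k + 2) p ↔ Rg k p c r := by
  simp only [Treg, Rg, Set.mem_setOf_eq]
  push_cast
  omega

theorem Treg_finite (i j p : ℕ) : (Treg i j p).Finite := by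
  apply Set.Finite.subset ((Set.finite_Icc (-(p:ℤ)) (2 * p + j)).prod
    (Set.finite_Icc (0:ℤ) (i + p)))
  rintro ⟨c, r⟩ h
  simp only [Treg, Set.mem_setOf_eq, Set.mem_prod, Set.mem_Icc] at *
  omega

open Classical in
theorem even_case (k p : ℕ) (hk : 0 < k) (hp : 0 < p) (he : Even k) :
    Odd (numTilings (Treg k (k + 2) p)) := by
  set R := Treg k (k + 2) p with hR
  have : Fintype R := (Treg_finite _ _ _).fintype
  rw [← ZMod.natCast_ne_zero_iff_odd, card_inv, card_inv_mod]
  intro hdet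
  obtain ⟨v, hv, hv0⟩ := Matrix.exists_mulVec_eq_zero_iff.2 hdet
  apply hv
  let f0 : ℤ × ℤ → ZMod 2 := fun x => if h : x ∈ R then v ⟨x, h⟩ else 0
  have hz := all_zero k p (fun c r => f0 (c + (p - 1), r)) (by obtain ⟨m, rfl⟩ := he; omega)
    (by omega) (by omega)
    (by
      intro c r h
      rw [← mem_Treg k p hp] at h
      simp only [f0]; rw [dif_neg h])
    (by
      intro c r h
      rw [← mem_Treg k p hp] at h
      have h1 := congrFun hv0 ⟨_, h⟩
      simp only [Matrix.mulVec, dotProduct, Matrix.of_apply, Pi.zero_apply, ite_mul, one_mul,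
        zero_mul] at h1
      rw [← h1]
      set x : ℤ × ℤ := (c + (p - 1), r) with hx
      have e1 : ∑ y : R, (if Adjacent x y.1 then v y else 0)
          = ∑ y : R, (if Adjacent x y.1 then f0 y.1 else 0) := by
        apply Finset.sum_congr rfl
        intro y _
        simp only [f0]; rw [dif_pos y.2]
      rw [e1]
      have e2 : ∑ y : R, (if Adjacent x y.1 then f0 y.1 else 0)
          = ∑ y ∈ (Treg_finite k (k+2) p).toFinset, (if Adjacent x y then f0 y else 0) := by
        rw [Finset.sum_subtype _ (p := fun y => y ∈ R)]
        intro y; simp [hR]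
      rw [e2]
      let S : Finset (ℤ × ℤ) := {(c - 1 + (p - 1), r), (c + 1 + (p - 1), r),
        (c + (p - 1), r - 1), (c + (p - 1), r + 1)}
      have hadj : ∀ y, Adjacent x y ↔ y ∈ S := by
        rintro ⟨a, b⟩
        simp only [S, hx, Adjacent, Finset.mem_insert, Finset.mem_singleton, Prod.mk.injEq]
        omega
      have e3 : ∑ y ∈ (Treg_finite k (k+2) p).toFinset, (if Adjacent x y then f0 y else 0)
          = ∑ y ∈ S, f0 y := by
        rw [← Finset.sum_filter]
        apply Finset.sum_subset
        · intro y hy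
          exact (hadj y).1 (Finset.mem_filter.1 hy).2
        · intro y hy hy'
          simp only [f0]
          rw [dif_neg]
          intro hyR
          exact hy' (Finset.mem_filter.2 ⟨by simpa [hR] using hyR, (hadj y).2 hy⟩)
      rw [e3]
      simp only [S]
      rw [Finset.sum_insert, Finset.sum_insert, Finset.sum_insert, Finset.sum_singleton]
      · ring
      all_goals
        simp only [Finset.mem_insert, Finset.mem_singleton, Prod.mk.injEq]
        omega)
  funext x
  have := hz (x.1.1 - (p - 1)) x.1.2
  simp only [sub_add_cancel, Prod.mk.eta, f0] at this
  rw [dif_pos x.2] at this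
  exact this

/-- Injection of odd cells in even cells (in shifted coordinates). -/
def phi (p c r : ℤ) : ℤ × ℤ :=
  if r ≤ p - 1 then (c - 1, r) else if (r - p) % 2 = 0 then (c, r + 1) else (c, r - 1)

theorem odd_case (k p : ℕ) (hp : 0 < p) (ho : Odd k) :
    numTilings (Treg k (k + 2) p) = 0 := by
  set R := Treg k (k + 2) p with hR
  rw [card_inv]
  have : Finite R := (Treg_finite _ _ _)
  rw [Nat.card_eq_zero]
  left
  constructor
  rintro ⟨σ, h1, -⟩
  have hk : (k : ℤ) % 2 = 1 := by obtain ⟨m, rfl⟩ := ho; omega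
  let E := {x : R // (x.1.1 - (p - 1) + x.1.2) % 2 = 0}
  have hmem : ∀ x : ℤ × ℤ, x ∈ R ↔ Rg k p (x.1 - (p - 1)) x.2 := by
    intro x
    rw [← mem_Treg k p hp]; simp [hR]
  have hodd : ∀ x : E, ((σ x.1).1.1 - (p - 1) + (σ x.1).1.2) % 2 = 1 := by
    intro x
    have a := h1 x.1
    have b := x.2
    unfold Adjacent at a
    omega
  let g : E → E := fun x =>
    ⟨⟨((phi p ((σ x.1).1.1 - (p - 1)) (σ x.1).1.2).1 + (p - 1),
      (phi p ((σ x.1).1.1 - (p - 1)) (σ x.1).1.2).2), by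
        have a := hodd x
        have b := (hmem _).1 (σ x.1).2
        rw [mem_Treg k p hp]
        unfold phi Rg at *
        split_ifs <;> simp only <;> omega⟩, by
        have a := hodd x
        simp only [add_sub_cancel_right]
        unfold phi
        split_ifs <;> simp only <;> omega⟩
  have hinj : Function.Injective g := by
    intro x y hxy
    have e := congrArg (fun z : E => z.1.1) hxy
    simp only [g, Prod.mk.injEq] at e
    apply Subtype.ext
    apply σ.injective
    apply Subtype.ext
    obtain ⟨e1, e2⟩ := e
    unfold phi at e1 e2
    apply Prod.ext
    · split_ifs at e1 e2 <;> simp only at e1 e2 <;> omega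
    · split_ifs at e1 e2 <;> simp only at e1 e2 <;> omega
  have hsurj := Finite.surjective_of_injective hinj
  obtain ⟨x, hx⟩ := hsurj ⟨⟨((k:ℤ) + 1 + (p - 1), 0), by
    rw [mem_Treg k p hp]; unfold Rg; omega⟩, by simp only; omega⟩
  have e := congrArg (fun z : E => z.1.1) hx
  simp only [g, Prod.mk.injEq] at e
  have b := (hmem _).1 (σ x.1).2
  obtain ⟨e1, e2⟩ := e
  unfold phi at e1 e2
  unfold Rg at b
  split_ifs at e1 e2 <;> simp only at e1 e2 <;> omega

theorem T_k_k2_parity (k p : ℕ) (hk : 0 < k) (hp : 0 < p) :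
    (Odd k → Even (numTilings (Treg k (k + 2) p))) ∧
    (Even k → Odd (numTilings (Treg k (k + 2) p))) := by
  refine ⟨fun h => ?_, fun h => even_case k p hk hp h⟩
  rw [odd_case k p hp h]
  exact Even.zero
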